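/- For every finite group G there exists a comparability graph X of dimension at most 4 with Aut(X) ≅ G. -/

import Mathlib

/-- Vertices of the subdivision of a bipartite incidence structure with sides `A`, `B` and edge
set `E`, together with one extra base vertex. -/
inductive IncVertex (A B E : Type) : Type
  | base : IncVertex A B E
  | left (a : A) : IncVertex A B E
  | right (b : B) : IncVertex A B E
  | edge (e : E) : IncVertex A B E

namespace IncVertex

variable {A B E : Type}

instance [Finite A] [Finite B] [Finite E] : Finite (IncVertex A B E) :=
  Finite.of_surjective
    (fun x : Option (A ⊕ B ⊕ E) => match x with
      | none => base
      | some (.inl a) => left a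
      | some (.inr (.inl b)) => right b
      | some (.inr (.inr e)) => edge e)
    (by
      rintro (_ | a | b | e)
      exacts [⟨none, rfl⟩, ⟨some (.inl a), rfl⟩, ⟨some (.inr (.inl b)), rfl⟩,
        ⟨some (.inr (.inr e)), rfl⟩])

variable (α : E → A) (β : E → B)

/-- The strict order: an edge lies above its two endpoints, and the base vertex lies below the
left side and all the edges. -/
def Below : IncVertex A B E → IncVertex A B E → Prop
  | base, left _ => True
  | base, edge _ => True
  | left a, edge e => α e = a
  | right b, edge e => β e = b
  | _, _ => False

/-- The comparability graph of `Below`. -/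
def graph : SimpleGraph (IncVertex A B E) where
  Adj x y := Below α β x y ∨ Below α β y x
  symm := ⟨fun _ _ h => h.symm⟩
  loopless := ⟨by rintro (_ | _ | _ | _) <;> simp [Below]⟩

/-- Rank in a linear extension grouping every edge with its left endpoint. -/
def leftKey (p : A → ℤ) (q : B → ℤ) (r : E → ℕ) : IncVertex A B E → ℤ ×ₗ ℤ ×ₗ ℤ
  | base => toLex (1, toLex (0, 0))
  | left a => toLex (2, toLex (p a, 0))
  | right b => toLex (0, toLex (q b, 0))
  | edge e => toLex (2, toLex (p (α e), 1 + r e))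

/-- Rank in a linear extension grouping every edge with its right endpoint. -/
def rightKey (p : A → ℤ) (q : B → ℤ) (r : E → ℕ) : IncVertex A B E → ℤ ×ₗ ℤ ×ₗ ℤ
  | base => toLex (0, toLex (0, 0))
  | left a => toLex (1, toLex (p a, 0))
  | right b => toLex (2, toLex (q b, 0))
  | edge e => toLex (2, toLex (q (β e), 1 + r e))

variable {α β} {p : A → ℤ} {q : B → ℤ} {r : E → ℕ}

theorem leftKey_injective (hp : p.Injective) (hq : q.Injective) (hr : r.Injective) :
    (leftKey α p q r).Injective := by
  rintro (_ | a | b | e) (_ | a' | b' | e') <;> simp [leftKey, hp.eq_iff, hq.eq_iff]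
  · omega
  · omega
  · intro _ h
    exact hr h

theorem rightKey_injective (hp : p.Injective) (hq : q.Injective) (hr : r.Injective) :
    (rightKey β p q r).Injective := by
  rintro (_ | a | b | e) (_ | a' | b' | e') <;> simp [rightKey, hp.eq_iff, hq.eq_iff]
  · omega
  · omega
  · intro _ h
    exact hr h

theorem isStrictTotalOrder_key {V K : Type*} [LinearOrder K] {k : V → K} (hk : k.Injective) :
    IsStrictTotalOrder V (fun x y => k x < k y) :=
  RelEmbedding.isStrictTotalOrder
    (⟨⟨k, hk⟩, Iff.rfl⟩ : (fun x y => k x < k y) ↪r ((· < ·) : K → K → Prop))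

theorem below_iff_keys (hp : p.Injective) (hq : q.Injective)
    (hαβ : ∀ e e', α e = α e' → β e = β e' → e = e') (x y : IncVertex A B E) :
    Below α β x y ↔
      leftKey α p q r x < leftKey α p q r y ∧ leftKey α (-p) q r x < leftKey α (-p) q r y ∧
      rightKey β p q r x < rightKey β p q r y ∧ rightKey β p (-q) r x < rightKey β p (-q) r y := by
  rcases x with _ | a | b | e <;> rcases y with _ | a' | b' | e' <;>
    simp only [Below, leftKey, rightKey, Prod.Lex.toLex_lt_toLex, Pi.neg_apply]
  case edge.edge =>
    by_cases h : e = e'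
    · subst h; simp
    · have : ¬ (p (α e) = p (α e') ∧ q (β e) = q (β e')) := fun ⟨h1, h2⟩ =>
        h (hαβ e e' (hp h1) (hq h2))
      simp
      omega
  all_goals try rw [← hp.eq_iff]
  all_goals try rw [← hq.eq_iff]
  all_goals simp
  all_goals omega

theorem graph_iso_base (hα : α.Surjective) [Nontrivial A] (f : graph α β ≃g graph α β) :
    f base = base := by
  have key : ∀ x y z, (graph α β).Adj x y → (graph α β).Adj y z → (graph α β).Adj x z →
      base = x ∨ base = y ∨ base = z := by
    rintro (_ | _ | _ | _) (_ | _ | _ | _) (_ | _ | _ | _) <;> simp [graph, Below]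
  have key' : ∀ e, f base = base ∨ f base = left (α e) ∨ f base = edge e := by
    intro e
    have := key (f.symm base) (f.symm (left (α e))) (f.symm (edge e))
      (f.symm.map_adj_iff.2 (by simp [graph, Below]))
      (f.symm.map_adj_iff.2 (by simp [graph, Below]))
      (f.symm.map_adj_iff.2 (by simp [graph, Below]))
    simpa [RelIso.eq_symm_apply] using this
  obtain ⟨a, a', h⟩ := exists_pair_ne A
  obtain ⟨e, rfl⟩ := hα a
  obtain ⟨e', rfl⟩ := hα a'
  have h1 := key' e
  have h2 := key' e'
  grind

theorem graph_iso_right (hα : α.Surjective) [Nontrivial A] (f : graph α β ≃g graph α β) (b : B) :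
    ∃ b', f (right b) = right b' := by
  have h0 := graph_iso_base hα f
  have h1 : ¬ (graph α β).Adj (f base) (f (right b)) := by
    rw [f.map_adj_iff]; simp [graph, Below]
  have h2 : f (right b) ≠ f base := by simp
  rw [h0] at h1 h2
  revert h1 h2
  rcases f (right b) with _ | _ | _ | _ <;> simp [graph, Below]

theorem graph_iso_edge (hα : α.Surjective) [Nontrivial A] (f : graph α β ≃g graph α β) (e : E) :
    ∃ e', f (edge e) = edge e' := by
  obtain ⟨b, hb⟩ := graph_iso_right hα f (β e)
  have h : (graph α β).Adj (f (right (β e))) (f (edge e)) := by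
    rw [f.map_adj_iff]; simp [graph, Below]
  rw [hb] at h
  revert h
  rcases f (edge e) with _ | _ | _ | _ <;> simp [graph, Below]

theorem graph_iso_left (hα : α.Surjective) [Nontrivial A] (f : graph α β ≃g graph α β) (a : A) :
    ∃ a', f (left a) = left a' := by
  rcases h : f (left a) with _ | a' | b | e
  · rw [← graph_iso_base hα f] at h
    simp at h
  · exact ⟨a', rfl⟩
  · obtain ⟨b', hb⟩ := graph_iso_right hα f.symm b
    rw [← h] at hb
    simp at hb
  · obtain ⟨b', hb⟩ := graph_iso_edge hα f.symm e
    rw [← h] at hb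
    simp at hb

/-- Automorphisms of the graph come from automorphisms of the incidence structure. -/
theorem graph_iso_induced (hα : α.Surjective) [Nontrivial A] (f : graph α β ≃g graph α β) :
    ∃ (u : A → A) (v : B → B) (w : E → E), (∀ a, f (left a) = left (u a)) ∧
      (∀ b, f (right b) = right (v b)) ∧ (∀ e, f (edge e) = edge (w e)) ∧
      (∀ e, α (w e) = u (α e)) ∧ ∀ e, β (w e) = v (β e) := by
  choose u hu using graph_iso_left hα f
  choose v hv using graph_iso_right hα f
  choose w hw using graph_iso_edge hα f
  refine ⟨u, v, w, hu, hv, hw, fun e => ?_, fun e => ?_⟩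
  · have : (graph α β).Adj (f (left (α e))) (f (edge e)) := by
      rw [f.map_adj_iff]; simp [graph, Below]
    rw [hu, hw] at this
    simpa [graph, Below] using this
  · have : (graph α β).Adj (f (right (β e))) (f (edge e)) := by
      rw [f.map_adj_iff]; simp [graph, Below]
    rw [hv, hw] at this
    simpa [graph, Below] using this

end IncVertex

namespace HalfGraphCover

open IncVertex

variable (G : Type)

/-- Index set of the fibres: `G` with two further least elements. -/
abbrev Index : Type := WithBot (WithBot G)

/-- Edges of the cover: edges of the half graph on `Index G`, lifted to each `g : G`. -/
abbrev Edge [LinearOrder G] : Type := G × {t : Index G × Index G // t.1 ≤ t.2}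

variable {G}

/-- Voltage of an edge of the half graph; every `s : G` occurs on an edge at the second least
index. -/
def voltage [One G] : Index G → Index G → G
  | some none, some (some s) => s
  | _, _ => 1

theorem voltage_self [One G] (i : Index G) : voltage i i = 1 := by
  rcases i with _ | _ | _ <;> rfl

theorem voltage_bot [One G] (j : Index G) : voltage ⊥ j = 1 := by
  rcases j with _ | _ | _ <;> rfl

theorem voltage_second [One G] (s : G) :
    voltage ((⊥ : WithBot G) : Index G) ((s : WithBot G) : Index G) = s :=
  rfl

variable [LinearOrder G]

/-- Left endpoint of an edge of the cover. -/
def src (e : Edge G) : G × Index G := (e.1, e.2.1.1)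

theorem src_surjective : (src (G := G)).Surjective :=
  fun a => ⟨(a.1, ⟨(a.2, a.2), le_rfl⟩), rfl⟩

variable [Group G]

/-- Right endpoint of an edge of the cover. -/
def tgt (e : Edge G) : G × Index G := (e.1 * voltage e.2.1.1 e.2.1.2, e.2.1.2)

theorem edge_ext (e e' : Edge G) (h : src e = src e') (h' : tgt e = tgt e') : e = e' := by
  obtain ⟨g, ⟨i, j⟩, hij⟩ := e
  obtain ⟨g', ⟨i', j'⟩, hij'⟩ := e'
  simp_all [src, tgt]

variable (G) in
/-- The graph of the half graph cover. -/
abbrev cover : SimpleGraph (IncVertex (G × Index G) (G × Index G) (Edge G)) := graph src tgt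

/-- Left translation on vertices. -/
def smulVertex (h : G) : IncVertex (G × Index G) (G × Index G) (Edge G) →
    IncVertex (G × Index G) (G × Index G) (Edge G)
  | base => base
  | left a => left (h * a.1, a.2)
  | right b => right (h * b.1, b.2)
  | edge e => edge (h * e.1, e.2)

theorem smulVertex_mul (h k : G) (x) : smulVertex (h * k) x = smulVertex h (smulVertex k x) := by
  rcases x with _ | _ | _ | _ <;> simp [smulVertex, mul_assoc]

theorem smulVertex_one (x) : smulVertex (1 : G) x = x := by
  rcases x with _ | _ | _ | _ <;> simp [smulVertex]

theorem below_smulVertex (h : G) (x y) :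
    Below src tgt (smulVertex h x) (smulVertex h y) ↔ Below src tgt x y := by
  rcases x with _ | ⟨g, i⟩ | ⟨g, i⟩ | e <;> rcases y with _ | ⟨g', i'⟩ | ⟨g', i'⟩ | e' <;>
    simp [smulVertex, Below, src, tgt, mul_assoc]

/-- Left translation as an automorphism. -/
def translate (h : G) : cover G ≃g cover G where
  toFun := smulVertex h
  invFun := smulVertex h⁻¹
  left_inv x := by rw [← smulVertex_mul, inv_mul_cancel, smulVertex_one]
  right_inv x := by rw [← smulVertex_mul, mul_inv_cancel, smulVertex_one]
  map_rel_iff' := or_congr (below_smulVertex ..) (below_smulVertex ..)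

variable (G) in
/-- Left translation as a homomorphism. -/
def translateHom : G →* (cover G ≃g cover G) :=
  MonoidHom.mk' translate fun h k => RelIso.ext fun x => smulVertex_mul h k x

theorem translateHom_injective : Function.Injective (translateHom G) := by
  intro h k hk
  have : smulVertex h (left (1, ⊥)) = smulVertex k (left (1, ⊥)) :=
    DFunLike.congr_fun hk (left (1, ⊥))
  simpa [smulVertex] using this

theorem iso_left_snd_le [Finite G] (f : cover G ≃g cover G) {a a' : G × Index G}
    (h : f (left a) = left a') : a'.2 ≤ a.2 := by
  classical
  have := Fintype.ofFinite G
  obtain ⟨u, v, w, hu, hv, hw, hα, hβ⟩ := graph_iso_induced src_surjective f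
  obtain ⟨g, i⟩ := a
  have hua : u (g, i) = a' := by simpa [hu] using h
  by_contra! hlt
  have hw_inj : w.Injective := fun e e' he => by
    have : f (edge e) = f (edge e') := by rw [hw, hw, he]
    simpa using this
  have hsrc : ∀ j (hj : i ≤ j), src (w (g, ⟨(i, j), hj⟩)) = a' := fun j hj => by
    rw [hα]; exact hua
  let F : {j // i ≤ j} → {j // a'.2 ≤ j} := fun j =>
    ⟨(w (g, ⟨(i, j), j.2⟩)).2.1.2, by
      have h1 := (w (g, ⟨(i, j), j.2⟩)).2.2
      have h2 := congrArg Prod.snd (hsrc j j.2)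
      exact h2 ▸ h1⟩
  have hF : F.Injective := by
    rintro ⟨j, hj⟩ ⟨k, hk⟩ hjk
    have h1 : w (g, ⟨(i, j), hj⟩) = w (g, ⟨(i, k), hk⟩) := by
      have h2 := (hsrc j hj).trans (hsrc k hk).symm
      refine edge_ext _ _ h2 ?_
      have h3 : (w (g, ⟨(i, j), hj⟩)).2.1.2 = (w (g, ⟨(i, k), hk⟩)).2.1.2 :=
        congrArg Subtype.val hjk
      simp only [src, Prod.mk.injEq] at h2
      simp only [tgt, h2, h3]
    simpa using hw_inj h1
  have hcard := Nat.card_le_card_of_injective F hF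
  have hss : {j | a'.2 ≤ j} ⊂ {j : Index G | i ≤ j} :=
    ⟨fun j hj => hlt.le.trans hj, fun hs => hlt.not_ge (hs (le_refl i))⟩
  exact (Set.ncard_lt_ncard hss (Set.toFinite _)).not_ge hcard

theorem iso_left_snd [Finite G] (f : cover G ≃g cover G) {a a' : G × Index G}
    (h : f (left a) = left a') : a'.2 = a.2 :=
  (iso_left_snd_le f h).antisymm (iso_left_snd_le f.symm (by rw [← h]; simp))

theorem iso_right_snd_le [Finite G] (f : cover G ≃g cover G) {b b' : G × Index G}
    (h : f (right b) = right b') : b.2 ≤ b'.2 := by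
  obtain ⟨u, v, w, hu, hv, hw, hα, hβ⟩ := graph_iso_induced src_surjective f
  obtain ⟨g, j⟩ := b
  have hvb : v (g, j) = b' := by simpa [hv] using h
  let e : Edge G := (g, ⟨(j, j), le_rfl⟩)
  have h1 : (w e).2.1.1 = j :=
    (congrArg Prod.snd (hα e)).trans (iso_left_snd f (hu (src e)))
  have h2 : tgt (w e) = b' := by
    rw [hβ, ← hvb]; simp [e, tgt, voltage_self]
  calc j = (w e).2.1.1 := h1.symm
    _ ≤ (w e).2.1.2 := (w e).2.2
    _ = b'.2 := congrArg Prod.snd h2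

theorem iso_right_snd [Finite G] (f : cover G ≃g cover G) {b b' : G × Index G}
    (h : f (right b) = right b') : b'.2 = b.2 :=
  (iso_right_snd_le f.symm (by rw [← h]; simp)).antisymm (iso_right_snd_le f h)

theorem translateHom_surjective [Finite G] : Function.Surjective (translateHom G) := by
  intro f
  obtain ⟨u, v, w, hu, hv, hw, hα, hβ⟩ := graph_iso_induced src_surjective f
  have hu2 : ∀ a, (u a).2 = a.2 := fun a => iso_left_snd f (hu a)
  have hv2 : ∀ b, (v b).2 = b.2 := fun b => iso_right_snd f (hv b)
  have hw2 : ∀ e, (w e).2 = e.2 := fun e => Subtype.ext (Prod.ext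
    ((congrArg Prod.snd (hα e)).trans (hu2 _)) ((congrArg Prod.snd (hβ e)).trans (hv2 _)))
  have hw1 : ∀ e, (w e).1 = (u (src e)).1 := fun e => congrArg Prod.fst (hα e)
  have huv : ∀ g i j, i ≤ j → (v (g * voltage i j, j)).1 = (u (g, i)).1 * voltage i j := by
    intro g i j hij
    have h1 := congrArg Prod.fst (hβ (g, ⟨(i, j), hij⟩))
    simp only [tgt, hw2, hw1] at h1
    exact h1.symm
  have hvbot : ∀ g j, (v (g, j)).1 = (u (g, ⊥)).1 := fun g j => by
    simpa [voltage_bot] using huv g ⊥ j bot_le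
  have hubot : ∀ g i, (u (g, i)).1 = (u (g, ⊥)).1 := fun g i => by
    simpa [voltage_self, hvbot] using (huv g i i le_rfl).symm
  have hmul : ∀ g s, (u (g * s, ⊥)).1 = (u (g, ⊥)).1 * s := fun g s => by
    have h1 := huv g ((⊥ : WithBot G) : Index G) ((s : WithBot G) : Index G)
      (WithBot.coe_le_coe.2 bot_le)
    rwa [voltage_second, hvbot, hubot g (WithBot.some ⊥)] at h1
  have hone : ∀ g, (u (g, ⊥)).1 = (u (1, ⊥)).1 * g := fun g => by
    simpa using hmul 1 g
  refine ⟨(u (1, ⊥)).1, RelIso.ext ?_⟩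
  rintro (_ | ⟨g, i⟩ | ⟨g, j⟩ | e)
  · exact (graph_iso_base src_surjective f).symm
  · rw [hu]
    exact congrArg left (Prod.ext (((hubot g i).trans (hone g)).symm) (hu2 (g, i)).symm)
  · rw [hv]
    exact congrArg right (Prod.ext (((hvbot g j).trans (hone g)).symm) (hv2 (g, j)).symm)
  · rw [hw]
    exact congrArg edge (Prod.ext (((hw1 e).trans ((hubot _ _).trans (hone e.1))).symm) (hw2 e).symm)

end HalfGraphCover

open IncVertex HalfGraphCover in
/-- Every finite group is the automorphism group of a comparability graph of
order dimension at most `4`. -/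
theorem finite_group_is_aut_of_4dim_comparability_graph
    (G : Type*) [Group G] [Finite G] :
    ∃ (V : Type) (_ : Fintype V) (X : SimpleGraph V)
      (L1 L2 L3 L4 : V → V → Prop),
      IsStrictTotalOrder V L1 ∧ IsStrictTotalOrder V L2 ∧
      IsStrictTotalOrder V L3 ∧ IsStrictTotalOrder V L4 ∧
      (∀ a b, X.Adj a b ↔
        ((L1 a b ∧ L2 a b ∧ L3 a b ∧ L4 a b) ∨
         (L1 b a ∧ L2 b a ∧ L3 b a ∧ L4 b a))) ∧
      Nonempty ((X ≃g X) ≃* G) := by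
  let _ : LinearOrder (Shrink.{0} G) :=
    LinearOrder.lift' (Finite.equivFin _) (Finite.equivFin _).injective
  have : Finite (Index (Shrink.{0} G)) := inferInstanceAs (Finite (Option (Option (Shrink.{0} G))))
  obtain ⟨p₀, hp₀⟩ := Countable.exists_injective_nat (Shrink.{0} G × Index (Shrink.{0} G))
  obtain ⟨r, hr⟩ := Countable.exists_injective_nat (Edge (Shrink.{0} G))
  let p : Shrink.{0} G × Index (Shrink.{0} G) → ℤ := fun a => p₀ a
  have hp : p.Injective := Nat.cast_injective.comp hp₀
  have hp' : (-p).Injective := neg_injective.comp hp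
  refine ⟨_, Fintype.ofFinite _, cover (Shrink.{0} G), _, _, _, _,
    isStrictTotalOrder_key (leftKey_injective hp hp hr),
    isStrictTotalOrder_key (leftKey_injective hp' hp hr),
    isStrictTotalOrder_key (rightKey_injective hp hp hr),
    isStrictTotalOrder_key (rightKey_injective hp hp' hr),
    fun a b => or_congr (below_iff_keys hp hp edge_ext a b) (below_iff_keys hp hp edge_ext b a),
    ⟨(MulEquiv.ofBijective (translateHom (Shrink.{0} G))
      ⟨translateHom_injective, translateHom_surjective⟩).symm.trans Shrink.mulEquiv⟩⟩
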